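/- For fixed j and p ∈ (0,1), Δ_j(n)/√n → 0 almost surely. -/

import Mathlib

open MeasureTheory ProbabilityTheory Filter
open scoped Topology

lemma aux_eLpNorm_one {Ω : Type*} {mΩ : MeasurableSpace Ω} {μ : Measure Ω}
    {f : Ω → ℝ} (hf : Integrable f μ) :
    eLpNorm f 1 μ = ENNReal.ofReal (∫ ω, |f ω| ∂μ) := by
  rw [eLpNorm_one_eq_lintegral_enorm, ← ofReal_integral_norm_eq_lintegral_enorm hf]
  rfl

lemma aux_condExp_sq {Ω : Type*} {mΩ : MeasurableSpace Ω} {μ : Measure Ω} [IsProbabilityMeasure μ]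
    {m : MeasurableSpace Ω} (hm : m ≤ mΩ) {X Y U V : Ω → ℝ}
    (hXm : StronglyMeasurable[m] X) (hX : Integrable X μ) (hY : Integrable Y μ)
    (hX2 : Integrable (fun ω => X ω ^ 2) μ) (hY2 : Integrable (fun ω => Y ω ^ 2) μ)
    (h1 : μ[fun ω => Y ω - X ω|m] =ᵐ[μ] U)
    (h2 : μ[fun ω => (Y ω - X ω) ^ 2|m] =ᵐ[μ] V) :
    μ[fun ω => Y ω ^ 2|m] =ᵐ[μ] fun ω => X ω ^ 2 + 2 * (X ω * U ω) + V ω := by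
  have LX : MemLp X 2 μ := (memLp_two_iff_integrable_sq hX.1).2 hX2
  have LY : MemLp Y 2 μ := (memLp_two_iff_integrable_sq hY.1).2 hY2
  have Ld : MemLp (fun ω => Y ω - X ω) 2 μ := LY.sub LX
  have i1 : Integrable (X * fun ω => Y ω - X ω) μ := LX.integrable_mul Ld
  have i2 : Integrable (fun ω => (Y ω - X ω) ^ 2) μ := Ld.integrable_sq
  have e : (fun ω => Y ω ^ 2) = (fun ω => X ω ^ 2) +
      (2 : ℝ) • (X * fun ω => Y ω - X ω) + (fun ω => (Y ω - X ω) ^ 2) := by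
    ext ω; simp; ring
  rw [e]
  have a1 := condExp_add (hX2.add (i1.smul (2 : ℝ))) i2 m
  have a2 := condExp_add hX2 (i1.smul (2 : ℝ)) m
  have a3 := condExp_smul (μ := μ) (2 : ℝ) (X * fun ω => Y ω - X ω) m
  have a4 := condExp_mul_of_stronglyMeasurable_left hXm i1 (hY.sub hX)
  have a5 : μ[fun ω => X ω ^ 2|m] = fun ω => X ω ^ 2 :=
    condExp_of_stronglyMeasurable hm (hXm.pow 2) hX2
  filter_upwards [a1, a2, a3, a4, h1, h2] with ω b1 b2 b3 b4 b5 b6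
  rw [b1, Pi.add_apply, b2, Pi.add_apply, b3, Pi.smul_apply, b4, Pi.mul_apply, b5, b6, a5]
  simp



/-- For fixed `j` and `p ∈ (0,1)`, the signed occurrence count of the negatively
step-reinforced random walk satisfies `Δ_j(n)/√n → 0` almost surely. -/
theorem signed_occurrence_count_sqrt_tendsto_zero
    {Ω : Type*} {mΩ : MeasurableSpace Ω} {μ : Measure Ω} [IsProbabilityMeasure μ]
    (p : ℝ) (hp : p ∈ Set.Ioo (0 : ℝ) 1)
    (j : ℕ) (hj : 1 ≤ j)
    (ℱ : Filtration ℕ mΩ) (Δ N : ℕ → Ω → ℝ)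
    (hadaptΔ : Adapted ℱ Δ) (hadaptN : Adapted ℱ N)
    (hintΔ : ∀ n, Integrable (Δ n) μ)
    (hintΔ2 : ∀ n, Integrable (fun ω => (Δ n ω) ^ 2) μ)
    (hintN : ∀ n, Integrable (N n) μ)
    (hnonnegN : ∀ n, 0 ≤ᵐ[μ] N n)
    (hcond1 : ∀ n, j ≤ n →
      μ[fun ω => Δ (n + 1) ω - Δ n ω|ℱ n] =ᵐ[μ] fun ω => -p * Δ n ω / n)
    (hcond2 : ∀ n, j ≤ n →
      μ[fun ω => (Δ (n + 1) ω - Δ n ω) ^ 2|ℱ n] =ᵐ[μ] fun ω => p * N n ω / n)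
    (c : ℝ)
    (hEN : Tendsto (fun n : ℕ => (∫ ω, N n ω ∂μ) / (n : ℝ) ^ p) atTop (𝓝 c)) :
    ∀ᵐ ω ∂μ, Tendsto (fun n : ℕ => Δ n ω / Real.sqrt n) atTop (𝓝 0) := by

  obtain ⟨hp0, hp1⟩ := hp
  have hsm : ∀ n, StronglyMeasurable[ℱ n] (Δ n) := fun n => (hadaptΔ n).stronglyMeasurable
  have hsN : ∀ n, StronglyMeasurable[ℱ n] (N n) := fun n => (hadaptN n).stronglyMeasurable
  have hE : ∀ n, j ≤ n → μ[fun ω => Δ (n + 1) ω ^ 2|ℱ n] =ᵐ[μ]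
      fun ω => Δ n ω ^ 2 + 2 * (Δ n ω * (-p * Δ n ω / n)) + p * N n ω / n := fun n hn =>
    aux_condExp_sq (ℱ.le n) (hsm n) (hintΔ n) (hintΔ (n + 1)) (hintΔ2 n) (hintΔ2 (n + 1))
      (hcond1 n hn) (hcond2 n hn)
  -- bound on `E N`
  obtain ⟨K, hK⟩ := hEN.bddAbove_range
  have hb0 : ∀ n, 0 ≤ ∫ ω, N n ω ∂μ := fun n => integral_nonneg_of_ae (hnonnegN n)
  have hb : ∀ n : ℕ, 1 ≤ n → ∫ ω, N n ω ∂μ ≤ K * (n : ℝ) ^ p := by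
    intro n hn
    have hn' : (0 : ℝ) < n := by exact_mod_cast hn
    have := hK (Set.mem_range_self n)
    rwa [div_le_iff₀ (Real.rpow_pos_of_pos hn' p)] at this
  -- second moments
  have hrec : ∀ n, j ≤ n → ∫ ω, Δ (n + 1) ω ^ 2 ∂μ ≤
      ∫ ω, Δ n ω ^ 2 ∂μ + p * K * (n : ℝ) ^ (p - 1) := by
    intro n hn
    have hn1 : 1 ≤ n := hj.trans hn
    have hn' : (0 : ℝ) < n := by exact_mod_cast hn1
    have hi : Integrable (fun ω => p * N n ω / n) μ := ((hintN n).const_mul p).div_const _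
    calc ∫ ω, Δ (n + 1) ω ^ 2 ∂μ = ∫ ω, (μ[fun ω => Δ (n + 1) ω ^ 2|ℱ n]) ω ∂μ :=
          (integral_condExp (ℱ.le n)).symm
      _ ≤ ∫ ω, (Δ n ω ^ 2 + p * N n ω / n) ∂μ := by
          refine integral_mono_ae integrable_condExp ((hintΔ2 n).add hi) ?_
          filter_upwards [hE n hn] with ω h
          rw [h]
          have : 0 ≤ p * Δ n ω ^ 2 / n := by positivity
          have e : 2 * (Δ n ω * (-p * Δ n ω / n)) = - (2 * (p * Δ n ω ^ 2 / n)) := by ring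
          rw [e]; linarith
      _ = ∫ ω, Δ n ω ^ 2 ∂μ + p * (∫ ω, N n ω ∂μ) / n := by
          rw [integral_add (hintΔ2 n) hi, integral_div, integral_const_mul]
      _ ≤ _ := by
          have := hb n hn1
          rw [Real.rpow_sub_one hn'.ne']
          have : p * (∫ ω, N n ω ∂μ) / n ≤ p * (K * (n : ℝ) ^ p) / n := by gcongr
          have e : p * (K * (n : ℝ) ^ p) / n = p * K * ((n : ℝ) ^ p / n) := by ring
          linarith
  have hsum : ∀ n, ∫ ω, Δ (n + j) ω ^ 2 ∂μ ≤
      ∫ ω, Δ j ω ^ 2 ∂μ + ∑ i ∈ Finset.range n, p * K * ((i + j : ℕ) : ℝ) ^ (p - 1) := by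
    intro n
    induction n with
    | zero => simp
    | succ n ih =>
      rw [Finset.sum_range_succ, show n + 1 + j = (n + j) + 1 by ring]
      have := hrec (n + j) (by omega)
      linarith
  have hev : Tendsto (fun n : ℕ => ∫ ω, Δ (n + j) ω ^ 2 / (n + j : ℕ) ∂μ) atTop (𝓝 0) := by
    have t0 : Tendsto (fun n : ℕ => p * K * ((n + j : ℕ) : ℝ) ^ (p - 1)) atTop (𝓝 0) := by
      have := (tendsto_rpow_neg_atTop (y := 1 - p) (by linarith)).comp
        (tendsto_natCast_atTop_atTop (R := ℝ))
      have := ((tendsto_add_atTop_iff_nat j).2 this).const_mul (p * K)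
      simpa using this
    have t1 := t0.cesaro
    have t2 : Tendsto (fun n : ℕ => (∫ ω, Δ j ω ^ 2 ∂μ) / (n : ℝ)) atTop (𝓝 0) :=
      tendsto_const_div_atTop_nhds_zero_nat _
    have t3 := t2.add t1
    rw [add_zero] at t3
    refine squeeze_zero' (Eventually.of_forall fun n => integral_nonneg fun ω => by positivity)
      ?_ t3
    filter_upwards [eventually_ge_atTop 1] with n hn
    have hn' : (0 : ℝ) < n := by exact_mod_cast hn
    rw [integral_div]
    have h0 : 0 ≤ ∫ ω, Δ (n + j) ω ^ 2 ∂μ := integral_nonneg fun ω => by positivity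
    calc (∫ ω, Δ (n + j) ω ^ 2 ∂μ) / ((n + j : ℕ) : ℝ) ≤ (∫ ω, Δ (n + j) ω ^ 2 ∂μ) / (n : ℝ) := by
          gcongr; omega
      _ ≤ (∫ ω, Δ j ω ^ 2 ∂μ + ∑ i ∈ Finset.range n, p * K * ((i + j : ℕ) : ℝ) ^ (p - 1)) / n := by
          gcongr; exact hsum n
      _ = _ := by ring
  -- the processes
  let 𝒢 : Filtration ℕ mΩ := ⟨fun n => ℱ (n + j), fun a b h => ℱ.mono (by omega),
    fun n => ℱ.le _⟩
  have hG : ∀ n, 𝒢 n = ℱ (n + j) := fun n => rfl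
  let v : ℕ → Ω → ℝ := fun n ω => Δ (n + j) ω ^ 2 / (n + j : ℕ)
  let B : ℕ → Ω → ℝ := fun n ω => p * N (n + j) ω / ((n + j : ℕ) : ℝ) ^ 2
  let A : ℕ → Ω → ℝ := fun n ω => ∑ i ∈ Finset.range n, B i ω
  have hvi : ∀ n, Integrable (v n) μ := fun n => (hintΔ2 _).div_const _
  have hv0 : ∀ n ω, 0 ≤ v n ω := fun n ω => by positivity
  have hBi : ∀ n, Integrable (B n) μ := fun n => ((hintN _).const_mul p).div_const _
  have hB0 : ∀ n, 0 ≤ᵐ[μ] B n := fun n => by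
    filter_upwards [hnonnegN (n + j)] with ω h
    have h' : 0 ≤ N (n + j) ω := h
    change 0 ≤ p * N (n + j) ω / ((n + j : ℕ) : ℝ) ^ 2
    positivity
  have hAi : ∀ n, Integrable (A n) μ := fun n => integrable_finsetSum _ fun i _ => hBi i
  have hBm : ∀ i n, i ≤ n → StronglyMeasurable[𝒢 n] (B i) := fun i n h =>
    (((((hadaptN (i + j)).const_mul p).div_const _)).mono (𝒢.mono h) le_rfl).stronglyMeasurable
  have hAm : ∀ n m, n ≤ m + 1 → StronglyMeasurable[𝒢 m] (A n) := fun n m h =>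
    Finset.stronglyMeasurable_fun_sum _ fun i hi => hBm i m (by
      have := Finset.mem_range.1 hi; omega)
  have hvm : ∀ n, StronglyMeasurable[𝒢 n] (v n) := fun n =>
    (((hadaptΔ (n + j)).pow_const 2).div_const _).stronglyMeasurable
  have hA0 : ∀ n, 0 ≤ᵐ[μ] A n := fun n => by
    filter_upwards [ae_all_iff.2 hB0] with ω h
    exact Finset.sum_nonneg fun i _ => h i
  have hAe : ∀ n m, n ≤ m + 1 → μ[A n|𝒢 m] = A n := fun n m h =>
    condExp_of_stronglyMeasurable (𝒢.le m) (hAm n m h) (hAi n)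
  have hAsub : Submartingale A 𝒢 μ := by
    refine submartingale_nat (fun n => hAm n n (by omega)) hAi fun n => ?_
    rw [hAe (n + 1) n le_rfl]
    filter_upwards [hB0 n] with ω h
    have h' : 0 ≤ B n ω := h
    change ∑ i ∈ Finset.range n, B i ω ≤ ∑ i ∈ Finset.range (n + 1), B i ω
    rw [Finset.sum_range_succ]; linarith
  have hSsub : Submartingale (fun n => A n - v n) 𝒢 μ := by
    refine submartingale_nat (fun n => (hAm n n (by omega)).sub (hvm n))
      (fun n => (hAi n).sub (hvi n)) fun n => ?_
    have c1 := condExp_sub (hAi (n + 1)) (hvi (n + 1)) (𝒢 n)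
    have ev : v (n + 1) = ((n + j + 1 : ℕ) : ℝ)⁻¹ • fun ω => Δ (n + j + 1) ω ^ 2 := by
      ext ω
      simp only [v, Pi.smul_apply, smul_eq_mul]
      rw [show n + 1 + j = n + j + 1 by ring]; ring
    have c2 := condExp_smul (μ := μ) (((n + j + 1 : ℕ) : ℝ)⁻¹) (fun ω => Δ (n + j + 1) ω ^ 2) (𝒢 n)
    rw [← ev] at c2
    filter_upwards [c1, c2, hE (n + j) (by omega), hnonnegN (n + j)] with ω d1 d2 d3 d4
    have d4' : 0 ≤ N (n + j) ω := d4
    rw [← hG] at d3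
    rw [d1, Pi.sub_apply, Pi.sub_apply, d2, hAe (n + 1) n le_rfl, Pi.smul_apply, d3]
    change (∑ i ∈ Finset.range n, B i ω) - Δ (n + j) ω ^ 2 / (n + j : ℕ) ≤
      ∑ i ∈ Finset.range (n + 1), B i ω - _
    rw [Finset.sum_range_succ]
    have hm : (0 : ℝ) < (n + j : ℕ) := by exact_mod_cast (by omega : 0 < n + j)
    simp only [B, smul_eq_mul]
    rw [Nat.cast_succ (n + j)]
    generalize ((n + j : ℕ) : ℝ) = m at *
    generalize N (n + j) ω = x at *
    generalize Δ (n + j) ω = y at *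
    have k1 : (m + 1)⁻¹ * (y ^ 2 + 2 * (y * (-p * y / m)) + p * x / m)
        ≤ m⁻¹ * (y ^ 2 + p * x / m) := by
      have : 0 ≤ p * y ^ 2 / m := by positivity
      have e : 2 * (y * (-p * y / m)) = - (2 * (p * y ^ 2 / m)) := by ring
      have h0 : 0 ≤ y ^ 2 + p * x / m := by positivity
      calc _ ≤ (m + 1)⁻¹ * (y ^ 2 + p * x / m) := by
            gcongr; rw [e]; linarith
        _ ≤ _ := by gcongr; linarith
    have k2 : m⁻¹ * (y ^ 2 + p * x / m) = y ^ 2 / m + p * x / m ^ 2 := by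
      field_simp
    linarith
  -- bounds
  have hsummable : Summable fun i : ℕ => p * K * ((i + j : ℕ) : ℝ) ^ (p - 2) := by
    have := (Real.summable_nat_rpow (p := p - 2)).2 (by linarith)
    exact ((summable_nat_add_iff j).2 this).mul_left (p * K)
  have hK0 : 0 ≤ K := by
    have := (hb0 1).trans (hb 1 le_rfl)
    simpa using this
  have hEA : ∀ n, ∫ ω, A n ω ∂μ ≤ ∑' i : ℕ, p * K * ((i + j : ℕ) : ℝ) ^ (p - 2) := by
    intro n
    have : ∫ ω, A n ω ∂μ = ∑ i ∈ Finset.range n, ∫ ω, B i ω ∂μ :=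
      integral_finsetSum _ fun i _ => hBi i
    rw [this]
    refine le_trans (Finset.sum_le_sum fun i _ => ?_)
      (hsummable.sum_le_tsum _ fun i _ => by positivity)
    have h1 : 1 ≤ i + j := by omega
    have hm : (0 : ℝ) < (i + j : ℕ) := by exact_mod_cast h1
    simp only [B]
    rw [integral_div, integral_const_mul, Real.rpow_sub hm, Real.rpow_two, mul_assoc, mul_div_assoc,
      ← mul_div_assoc K]
    gcongr
    exact hb _ h1
  obtain ⟨R, hR⟩ := hev.bddAbove_range
  set T := ∑' i : ℕ, p * K * ((i + j : ℕ) : ℝ) ^ (p - 2) with hT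
  have hAabs : ∀ n, ∫ ω, |A n ω| ∂μ = ∫ ω, A n ω ∂μ := fun n => by
    refine integral_congr_ae ?_
    filter_upwards [hA0 n] with ω h
    exact abs_of_nonneg h
  have limA : ∀ᵐ ω ∂μ, ∃ c, Tendsto (fun n => A n ω) atTop (𝓝 c) := by
    refine hAsub.exists_ae_tendsto_of_bdd (R := T.toNNReal) fun n => ?_
    rw [aux_eLpNorm_one (hAi n), hAabs]
    exact ENNReal.ofReal_le_ofReal (hEA n)
  have limS : ∀ᵐ ω ∂μ, ∃ c, Tendsto (fun n => (A n - v n) ω) atTop (𝓝 c) := by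
    refine hSsub.exists_ae_tendsto_of_bdd (R := (T + R).toNNReal) fun n => ?_
    rw [aux_eLpNorm_one ((hAi n).sub (hvi n))]
    refine ENNReal.ofReal_le_ofReal ?_
    calc ∫ ω, |(A n - v n) ω| ∂μ ≤ ∫ ω, (|A n ω| + v n ω) ∂μ := by
          refine integral_mono ((hAi n).sub (hvi n)).abs ((hAi n).abs.add (hvi n)) fun ω => ?_
          have := abs_sub (A n ω) (v n ω)
          rwa [abs_of_nonneg (hv0 n ω)] at this
      _ = ∫ ω, A n ω ∂μ + ∫ ω, v n ω ∂μ := by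
          rw [integral_add (hAi n).abs (hvi n), hAabs]
      _ ≤ T + R := add_le_add (hEA n) (hR (Set.mem_range_self n))
  have hmeas : TendstoInMeasure μ v atTop (fun _ => (0 : ℝ)) := by
    refine tendstoInMeasure_of_tendsto_eLpNorm one_ne_zero (fun n => (hvi n).1)
      aestronglyMeasurable_const ?_
    have : ∀ n, eLpNorm (v n - fun _ => (0 : ℝ)) 1 μ = ENNReal.ofReal (∫ ω, v n ω ∂μ) := by
      intro n
      have e : (v n - fun _ => (0 : ℝ)) = v n := by ext ω; simp
      rw [e, aux_eLpNorm_one (hvi n)]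
      simp only [abs_of_nonneg (hv0 n _)]
    simp only [this]
    have h := ENNReal.tendsto_ofReal hev
    rw [ENNReal.ofReal_zero] at h
    exact h
  obtain ⟨ns, hns, hlim⟩ := hmeas.exists_seq_tendsto_ae
  filter_upwards [limA, limS, hlim] with ω ⟨a, ha⟩ ⟨s, hs⟩ h0
  have hv : Tendsto (fun n => v n ω) atTop (𝓝 (a - s)) := by
    refine (ha.sub hs).congr fun n => ?_
    simp
  have hz : a - s = 0 := tendsto_nhds_unique (hv.comp hns.tendsto_atTop) h0
  rw [hz] at hv
  rw [← tendsto_add_atTop_iff_nat j]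
  rw [tendsto_zero_iff_abs_tendsto_zero]
  have := hv.sqrt
  rw [Real.sqrt_zero] at this
  refine this.congr fun n => ?_
  simp only [v, Function.comp]
  rw [Real.sqrt_div (sq_nonneg _), Real.sqrt_sq_eq_abs, abs_div, abs_of_nonneg (Real.sqrt_nonneg _)]
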